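/- For |q|<1, E(q^2)^{10}/(E(q)^4 E(q^4)^4) - E(q^{10})^{10}/(E(q^5)^4 E(q^{20})^4) = 4q E(q^2)^2 E(q^5) E(q^{20})/(E(q) E(q^4)), where E(q) = ∏_{k≥0}(1-q^{k+1}). -/

import Mathlib

/-- Euler's product E(q) = ∏_{k≥0} (1 - q^{k+1}). -/
noncomputable def E (q : ℂ) : ℂ := ∏' k : ℕ, (1 - q ^ (k + 1))

/-- q-Pochhammer infinite product (a;q)_∞ = ∏_{k≥0} (1 - a q^k). -/
noncomputable def qp (a q : ℂ) : ℂ := ∏' k : ℕ, (1 - a * q ^ k)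

/-- Rogers–Ramanujan function G(q) = 1/((q,q^4;q^5)_∞). -/
noncomputable def G (q : ℂ) : ℂ := 1 / (qp q (q ^ 5) * qp (q ^ 4) (q ^ 5))

/-- Rogers–Ramanujan function H(q) = 1/((q^2,q^3;q^5)_∞). -/
noncomputable def H (q : ℂ) : ℂ := 1 / (qp (q ^ 2) (q ^ 5) * qp (q ^ 3) (q ^ 5))

/-- Rogers–Ramanujan continued fraction product R(q). -/
noncomputable def R (q : ℂ) : ℂ :=
  (qp q (q ^ 5) * qp (q ^ 4) (q ^ 5)) / (qp (q ^ 2) (q ^ 5) * qp (q ^ 3) (q ^ 5))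

open Filter Topology Finset

theorem norm_pow_lt_one {q : ℂ} (hq : ‖q‖ < 1) {n : ℕ} (hn : n ≠ 0) : ‖q ^ n‖ < 1 := by
  rw [norm_pow]
  exact pow_lt_one₀ (norm_nonneg _) hq hn

theorem multipliable_qp (a : ℂ) {q : ℂ} (hq : ‖q‖ < 1) :
    Multipliable fun k : ℕ => 1 - a * q ^ k := by
  simp_rw [sub_eq_add_neg]
  apply multipliable_one_add_of_summable
  simpa using (summable_geometric_of_lt_one (norm_nonneg q) hq).mul_left ‖a‖

theorem tendsto_qp (a : ℂ) {q : ℂ} (hq : ‖q‖ < 1) :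
    Tendsto (fun n => ∏ k ∈ range n, (1 - a * q ^ k)) atTop (𝓝 (qp a q)) :=
  (multipliable_qp a hq).tendsto_prod_tprod_nat

theorem E_eq_qp (q : ℂ) : E q = qp q q := by
  simp [E, qp, pow_succ']

theorem qp_dissection (a : ℂ) {q : ℂ} (hq : ‖q‖ < 1) {m : ℕ} (hm : m ≠ 0) :
    qp a q = ∏ i ∈ range m, qp (a * q ^ i) (q ^ m) := by
  have hqm : ‖q ^ m‖ < 1 := norm_pow_lt_one hq hm
  have h1 := (tendsto_qp a hq).comp (tendsto_id.const_mul_atTop' (Nat.pos_of_ne_zero hm))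
  have h2 := tendsto_finsetProd (range m) fun i _ => tendsto_qp (a * q ^ i) hqm
  refine tendsto_nhds_unique h1 (h2.congr fun n => ?_)
  simp only [Function.comp_apply, id_eq]
  induction n with
  | zero => simp
  | succ n ih =>
    simp_rw [prod_range_succ, prod_mul_distrib]
    rw [ih, Nat.mul_succ, prod_range_add]
    congr 1
    refine prod_congr rfl fun i _ => ?_
    ring

theorem qp_mul_qp_neg (a : ℂ) {q : ℂ} (hq : ‖q‖ < 1) :
    qp a q * qp (-a) q = qp (a ^ 2) (q ^ 2) := by
  rw [qp, qp, qp, ← (multipliable_qp a hq).tprod_mul (multipliable_qp (-a) hq)]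
  congr 1
  ext k
  ring

theorem one_sub_pow_succ_ne_zero {q : ℂ} (hq : ‖q‖ < 1) (k : ℕ) : 1 - q ^ (k + 1) ≠ 0 := by
  intro h
  have h1 : q ^ (k + 1) = 1 := by linear_combination -h
  have h2 : ‖q ^ (k + 1)‖ < 1 := norm_pow_lt_one hq k.succ_ne_zero
  simp [h1] at h2

theorem E_ne_zero {q : ℂ} (hq : ‖q‖ < 1) : E q ≠ 0 := by
  simp_rw [E, sub_eq_add_neg]
  refine tprod_one_add_ne_zero_of_summable (f := fun k : ℕ => -q ^ (k + 1)) (fun k h => ?_) ?_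
  · exact one_sub_pow_succ_ne_zero hq k (by simpa [sub_eq_add_neg] using h)
  · simpa using (summable_nat_add_iff 1).mpr (summable_geometric_of_lt_one (norm_nonneg q) hq)

/-- The finite product `(x;x)_n`. -/
noncomputable def qFactorial (x : ℂ) (n : ℕ) : ℂ := ∏ k ∈ range n, (1 - x ^ (k + 1))

/-- The reciprocal of `(x;x)_m`, extended by zero to negative `m`. -/
noncomputable def invQFactorial (x : ℂ) (m : ℤ) : ℂ :=
  if m < 0 then 0 else (qFactorial x m.toNat)⁻¹

theorem invQFactorial_natCast (x : ℂ) (n : ℕ) : invQFactorial x n = (qFactorial x n)⁻¹ := by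
  simp [invQFactorial]

theorem invQFactorial_of_neg (x : ℂ) {m : ℤ} (hm : m < 0) : invQFactorial x m = 0 := by
  simp [invQFactorial, hm]

theorem invQFactorial_eq {x : ℂ} (hx : ‖x‖ < 1) (m : ℤ) :
    invQFactorial x m = (1 - x ^ (m + 1)) * invQFactorial x (m + 1) := by
  rcases lt_trichotomy m (-1) with h | rfl | h
  · rw [invQFactorial_of_neg x (by omega), invQFactorial_of_neg x (by omega), mul_zero]
  · rw [invQFactorial_of_neg x (by omega)]
    simp
  · lift m to ℕ using by omega
    rw [← Nat.cast_succ, invQFactorial_natCast, invQFactorial_natCast, zpow_natCast, qFactorial,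
      qFactorial, prod_range_succ, mul_inv, mul_left_comm,
      mul_inv_cancel₀ (one_sub_pow_succ_ne_zero hx m), mul_one]

theorem tendsto_qFactorial {x : ℂ} (hx : ‖x‖ < 1) :
    Tendsto (qFactorial x) atTop (𝓝 (E x)) := by
  rw [E_eq_qp]
  refine (tendsto_qp x hx).congr fun n => ?_
  simp [qFactorial, pow_succ']

theorem tendsto_invQFactorial {x : ℂ} (hx : ‖x‖ < 1) :
    Tendsto (invQFactorial x) atTop (𝓝 (E x)⁻¹) := by
  rw [← Nat.map_cast_int_atTop, tendsto_map'_iff]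
  exact ((tendsto_qFactorial hx).inv₀ (E_ne_zero hx)).congr fun n =>
    (invQFactorial_natCast x n).symm

theorem exists_norm_qFactorial_le {x : ℂ} (hx : ‖x‖ < 1) : ∃ C, ∀ n, ‖qFactorial x n‖ ≤ C := by
  obtain ⟨C, hC⟩ := (Metric.isBounded_range_of_tendsto _ (tendsto_qFactorial hx)).exists_norm_le
  exact ⟨C, fun n => hC _ ⟨n, rfl⟩⟩

theorem exists_norm_invQFactorial_le {x : ℂ} (hx : ‖x‖ < 1) :
    ∃ C, ∀ m, ‖invQFactorial x m‖ ≤ C := by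
  obtain ⟨C, hC⟩ := (Metric.isBounded_range_of_tendsto _
    ((tendsto_qFactorial hx).inv₀ (E_ne_zero hx))).exists_norm_le
  refine ⟨C, fun m => ?_⟩
  rcases lt_or_ge m 0 with h | h
  · rw [invQFactorial_of_neg x h, norm_zero]
    exact (norm_nonneg _).trans (hC _ ⟨0, rfl⟩)
  · lift m to ℕ using h
    rw [invQFactorial_natCast]
    exact hC _ ⟨m, rfl⟩

/-- The finite form of the Jacobi triple product identity. -/
theorem hasSum_finite_jacobi {q z : ℂ} (hq : ‖q‖ < 1) (hq0 : q ≠ 0) (hz : z ≠ 0) (n : ℕ) :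
    HasSum (fun j : ℤ => qFactorial (q ^ 2) (2 * n) * invQFactorial (q ^ 2) (n + j) *
        invQFactorial (q ^ 2) (n - j) * (q ^ (j ^ 2) * z ^ j))
      (∏ k ∈ range n, (1 + z * q ^ (2 * k + 1)) * (1 + z⁻¹ * q ^ (2 * k + 1))) := by
  have hx : ‖q ^ 2‖ < 1 := norm_pow_lt_one hq two_ne_zero
  induction n with
  | zero =>
    convert hasSum_single (0 : ℤ) fun j hj => ?_ using 1
    · simp [qFactorial, invQFactorial]
    · rcases lt_or_gt_of_ne hj with h | h
      · rw [invQFactorial_of_neg _ (m := ((0 : ℕ) : ℤ) + j) (by simpa using h)]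
        simp
      · rw [invQFactorial_of_neg _ (m := ((0 : ℕ) : ℤ) - j) (by simpa using h)]
        simp
  | succ n ih =>
    have hl := (((Equiv.subRight (1 : ℤ)).hasSum_iff).mpr ih).mul_left (z * q ^ (2 * n + 1))
    have hr := (((Equiv.addRight (1 : ℤ)).hasSum_iff).mpr ih).mul_left (z⁻¹ * q ^ (2 * n + 1))
    have hc := ih.mul_left (1 + q ^ (4 * n + 2))
    refine (congrArg₂ (HasSum · ·) (funext fun j => ?_) ?_).mpr ((hc.add hl).add hr)
    · simp only [Function.comp_apply, Equiv.subRight_apply, Equiv.coe_addRight]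
      have ha : invQFactorial (q ^ 2) (n + j) =
          (1 - (q ^ 2) ^ (n + j + 1 : ℤ)) * invQFactorial (q ^ 2) (n + j + 1) :=
        invQFactorial_eq hx _
      have ha' : invQFactorial (q ^ 2) (n + j - 1) =
          (1 - (q ^ 2) ^ (n + j : ℤ)) * invQFactorial (q ^ 2) (n + j) := by
        simpa using invQFactorial_eq hx (n + j - 1)
      have hb : invQFactorial (q ^ 2) (n - j) =
          (1 - (q ^ 2) ^ (n - j + 1 : ℤ)) * invQFactorial (q ^ 2) (n - j + 1) :=
        invQFactorial_eq hx _
      have hb' : invQFactorial (q ^ 2) (n - j - 1) =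
          (1 - (q ^ 2) ^ (n - j : ℤ)) * invQFactorial (q ^ 2) (n - j) := by
        simpa using invQFactorial_eq hx (n - j - 1)
      rw [show ((n + 1 : ℕ) : ℤ) + j = n + j + 1 by push_cast; ring,
        show ((n + 1 : ℕ) : ℤ) - j = n - j + 1 by push_cast; ring,
        show (n : ℤ) + (j - 1) = n + j - 1 by ring, show (n : ℤ) - (j - 1) = n - j + 1 by ring,
        show (n : ℤ) + (j + 1) = n + j + 1 by ring, show (n : ℤ) - (j + 1) = n - j - 1 by ring,
        ha', hb', ha, hb]
      have hP : qFactorial (q ^ 2) (2 * (n + 1)) = qFactorial (q ^ 2) (2 * n) *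
          (1 - q ^ (4 * n + 2)) * (1 - q ^ (4 * n + 4)) := by
        rw [qFactorial, qFactorial, Nat.mul_succ, prod_range_succ, prod_range_succ]
        ring
      rw [hP]
      generalize invQFactorial (q ^ 2) (n + j + 1) = r
      generalize invQFactorial (q ^ 2) (n - j + 1) = s
      have hq2 : q ^ 2 ≠ 0 := pow_ne_zero 2 hq0
      have e1 : q ^ (j - 1) ^ 2 = q ^ j ^ 2 * ((q ^ j) ^ 2)⁻¹ * q := by
        rw [← zpow_natCast (q ^ j), ← zpow_mul, ← zpow_neg, ← zpow_add₀ hq0, ← zpow_add_one₀ hq0]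
        congr 1
        push_cast
        ring
      have e2 : q ^ (j + 1) ^ 2 = q ^ j ^ 2 * (q ^ j) ^ 2 * q := by
        rw [← zpow_natCast (q ^ j), ← zpow_mul, ← zpow_add₀ hq0, ← zpow_add_one₀ hq0]
        congr 1
        push_cast
        ring
      have e3 : (q ^ 2) ^ (n + j : ℤ) = (q ^ n) ^ 2 * (q ^ j) ^ 2 := by
        rw [zpow_add₀ hq2, zpow_natCast, ← pow_mul, mul_comm 2 n, pow_mul, ← zpow_natCast q 2,
          ← zpow_mul, mul_comm _ j, zpow_mul, zpow_natCast]
      have e4 : (q ^ 2) ^ (n - j : ℤ) = (q ^ n) ^ 2 * ((q ^ j) ^ 2)⁻¹ := by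
        rw [zpow_sub₀ hq2, zpow_natCast, ← pow_mul, mul_comm 2 n, pow_mul, ← zpow_natCast q 2,
          ← zpow_mul, mul_comm _ j, zpow_mul, zpow_natCast, div_eq_mul_inv]
      rw [zpow_add_one₀ hq2, zpow_add_one₀ hq2, e1, e2, e3, e4, zpow_sub_one₀ hz, zpow_add_one₀ hz,
        show q ^ (4 * n + 2) = (q ^ n) ^ 4 * q ^ 2 by ring,
        show q ^ (4 * n + 4) = (q ^ n) ^ 4 * q ^ 4 by ring,
        show q ^ (2 * n + 1) = (q ^ n) ^ 2 * q by ring]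
      have hw : q ^ j ≠ 0 := zpow_ne_zero j hq0
      generalize q ^ j = w at *
      generalize q ^ j ^ 2 = Q
      generalize z ^ j = Z
      generalize q ^ n = y
      field_simp
      ring
    · rw [prod_range_succ]
      have : (1 + z * q ^ (2 * n + 1)) * (1 + z⁻¹ * q ^ (2 * n + 1)) =
          (1 + q ^ (4 * n + 2)) + z * q ^ (2 * n + 1) + z⁻¹ * q ^ (2 * n + 1) := by
        field_simp
        ring
      rw [this]
      ring

theorem summable_pow_sq_mul_pow {r : ℝ} (hr0 : 0 < r) (hr : r < 1) {w : ℝ} (hw : 0 < w) :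
    Summable fun n : ℕ => r ^ (n ^ 2) * w ^ n := by
  refine summable_of_ratio_test_tendsto_lt_one zero_lt_one
    (Eventually.of_forall fun n => by positivity) ?_
  have h : Tendsto (fun n : ℕ => (r ^ 2) ^ n * (r * w)) atTop (𝓝 (0 * (r * w))) :=
    (tendsto_pow_atTop_nhds_zero_of_lt_one (by positivity)
      (pow_lt_one₀ hr0.le hr two_ne_zero)).mul_const _
  rw [zero_mul] at h
  refine h.congr fun n => ?_
  rw [Real.norm_of_nonneg (by positivity), Real.norm_of_nonneg (by positivity),
    eq_div_iff (by positivity)]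
  ring

theorem summable_norm_theta {q z : ℂ} (hq : ‖q‖ < 1) (hq0 : q ≠ 0) (hz : z ≠ 0) :
    Summable fun j : ℤ => ‖q ^ (j ^ 2) * z ^ j‖ := by
  have h0 : 0 < ‖q‖ := norm_pos_iff.mpr hq0
  have h1 : 0 < ‖z‖ := norm_pos_iff.mpr hz
  refine Summable.of_nat_of_neg ?_ ?_
  · refine (summable_pow_sq_mul_pow h0 hq h1).congr fun n => ?_
    rw [norm_mul, norm_zpow, norm_zpow, zpow_natCast, ← Nat.cast_pow, zpow_natCast]
  · refine (summable_pow_sq_mul_pow h0 hq (inv_pos.mpr h1)).congr fun n => ?_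
    rw [norm_mul, norm_zpow, norm_zpow, zpow_neg, zpow_natCast, neg_sq, ← Nat.cast_pow,
      zpow_natCast, inv_pow]

/-- The **Jacobi triple product** identity. -/
theorem jacobi_triple_product {q z : ℂ} (hq : ‖q‖ < 1) (hq0 : q ≠ 0) (hz : z ≠ 0) :
    ∑' j : ℤ, q ^ (j ^ 2) * z ^ j =
      E (q ^ 2) * qp (-(z * q)) (q ^ 2) * qp (-(z⁻¹ * q)) (q ^ 2) := by
  have hx : ‖q ^ 2‖ < 1 := norm_pow_lt_one hq two_ne_zero
  have hE := E_ne_zero hx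
  obtain ⟨C, hC⟩ := exists_norm_qFactorial_le hx
  obtain ⟨D, hD⟩ := exists_norm_invQFactorial_le hx
  have hC0 : 0 ≤ C := (norm_nonneg _).trans (hC 0)
  have hD0 : 0 ≤ D := (norm_nonneg _).trans (hD 0)
  have hprod : Tendsto (fun n : ℕ => ∏ k ∈ range n,
      (1 + z * q ^ (2 * k + 1)) * (1 + z⁻¹ * q ^ (2 * k + 1))) atTop
      (𝓝 (qp (-(z * q)) (q ^ 2) * qp (-(z⁻¹ * q)) (q ^ 2))) := by
    refine ((tendsto_qp _ hx).mul (tendsto_qp _ hx)).congr fun n => ?_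
    rw [← prod_mul_distrib]
    refine prod_congr rfl fun k _ => ?_
    ring
  have hsum : Tendsto (fun n : ℕ => ∏ k ∈ range n,
      (1 + z * q ^ (2 * k + 1)) * (1 + z⁻¹ * q ^ (2 * k + 1))) atTop
      (𝓝 (∑' j : ℤ, E (q ^ 2) * (E (q ^ 2))⁻¹ * (E (q ^ 2))⁻¹ * (q ^ (j ^ 2) * z ^ j))) := by
    simp_rw [← (hasSum_finite_jacobi hq hq0 hz _).tsum_eq]
    refine tendsto_tsum_of_dominated_convergence
      (bound := fun j : ℤ => C * D * D * ‖q ^ (j ^ 2) * z ^ j‖)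
      ((summable_norm_theta hq hq0 hz).mul_left _) (fun j => ?_)
      (Eventually.of_forall fun n j => ?_)
    · have h1 : Tendsto (fun n : ℕ => 2 * n) atTop atTop :=
        tendsto_id.const_mul_atTop' two_pos
      have h2 : Tendsto (fun n : ℕ => (n : ℤ) + j) atTop atTop :=
        tendsto_atTop_add_const_right _ _ tendsto_natCast_atTop_atTop
      have h3 : Tendsto (fun n : ℕ => (n : ℤ) - j) atTop atTop :=
        tendsto_atTop_add_const_right _ _ tendsto_natCast_atTop_atTop
      exact ((((tendsto_qFactorial hx).comp h1).mul ((tendsto_invQFactorial hx).comp h2)).mul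
        ((tendsto_invQFactorial hx).comp h3)).mul_const _
    · rw [norm_mul, norm_mul, norm_mul]
      gcongr
      · exact hC _
      · exact hD _
      · exact hD _
  have h := tendsto_nhds_unique hsum hprod
  rw [mul_inv_cancel₀ hE, one_mul, tsum_mul_left] at h
  rw [mul_assoc, ← h, mul_inv_cancel_left₀ hE]

/-- The representatives in `ℤ²` of the cosets of the sublattice generated by `(1, 2)` and
`(-2, 1)`. -/
def cosetRep : Fin 5 → ℤ × ℤ := ![(0, 0), (1, 0), (-1, 0), (0, 1), (0, -1)]

theorem bijective_cosets : Function.Bijective fun p : Fin 5 × ℤ × ℤ =>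
    (p.2.1 - 2 * p.2.2 + (cosetRep p.1).1, 2 * p.2.1 + p.2.2 + (cosetRep p.1).2) := by
  constructor
  · rintro ⟨i, u, v⟩ ⟨j, u', v'⟩ h
    rw [Prod.mk.injEq] at h
    fin_cases i <;> fin_cases j <;> simp [cosetRep] at h ⊢ <;> omega
  · rintro ⟨x, y⟩
    have key : ∀ i : Fin 5, (x - (cosetRep i).1 + 2 * (y - (cosetRep i).2)) % 5 = 0 →
        ∃ p : Fin 5 × ℤ × ℤ, (p.2.1 - 2 * p.2.2 + (cosetRep p.1).1,
          2 * p.2.1 + p.2.2 + (cosetRep p.1).2) = (x, y) := by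
      intro i hi
      obtain ⟨u, hu⟩ := Int.dvd_of_emod_eq_zero hi
      refine ⟨(i, u, y - (cosetRep i).2 - 2 * u), ?_⟩
      ext
      · dsimp only
        linarith
      · dsimp only
        ring
    have h : (x + 2 * y) % 5 = 0 ∨ (x + 2 * y) % 5 = 1 ∨ (x + 2 * y) % 5 = 4 ∨
        (x + 2 * y) % 5 = 2 ∨ (x + 2 * y) % 5 = 3 := by omega
    rcases h with h | h | h | h | h
    · exact key 0 (by simp [cosetRep]; omega)
    · exact key 1 (by simp [cosetRep]; omega)
    · exact key 2 (by simp [cosetRep]; omega)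
    · exact key 3 (by simp [cosetRep]; omega)
    · exact key 4 (by simp [cosetRep]; omega)

/-- The general theta series `∑ q ^ (j ^ 2) z ^ j`. -/
noncomputable def thetaSeries (q z : ℂ) : ℂ := ∑' j : ℤ, q ^ (j ^ 2) * z ^ j

theorem thetaSeries_inv (q z : ℂ) : thetaSeries q z⁻¹ = thetaSeries q z := by
  rw [thetaSeries, thetaSeries, ← (Equiv.neg ℤ).tsum_eq]
  simp

theorem summable_theta_mul {q z w : ℂ} (hq : ‖q‖ < 1) (hq0 : q ≠ 0) (hz : z ≠ 0) (hw : w ≠ 0) :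
    Summable fun p : ℤ × ℤ => q ^ (p.1 ^ 2) * z ^ p.1 * (q ^ (p.2 ^ 2) * w ^ p.2) :=
  summable_mul_of_summable_norm (f := fun j : ℤ => q ^ (j ^ 2) * z ^ j)
    (g := fun j : ℤ => q ^ (j ^ 2) * w ^ j) (summable_norm_theta hq hq0 hz)
    (summable_norm_theta hq hq0 hw)

theorem thetaSeries_mul {q z w : ℂ} (hq : ‖q‖ < 1) (hq0 : q ≠ 0) (hz : z ≠ 0) (hw : w ≠ 0) :
    thetaSeries q z * thetaSeries q w =
      ∑' p : ℤ × ℤ, q ^ (p.1 ^ 2) * z ^ p.1 * (q ^ (p.2 ^ 2) * w ^ p.2) :=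
  tsum_mul_tsum_of_summable_norm (summable_norm_theta hq hq0 hz) (summable_norm_theta hq hq0 hw)

theorem thetaSeries_sq_eq {q : ℂ} (hq : ‖q‖ < 1) (hq0 : q ≠ 0) :
    thetaSeries q 1 ^ 2 = thetaSeries (q ^ 5) 1 ^ 2 +
      4 * q * (thetaSeries (q ^ 5) (q ^ 4) * thetaSeries (q ^ 5) (q ^ 2)) := by
  have hq5 : ‖q ^ 5‖ < 1 := norm_pow_lt_one hq (by norm_num)
  have hq50 : q ^ 5 ≠ 0 := pow_ne_zero 5 hq0
  have hq40 : q ^ 4 ≠ 0 := pow_ne_zero 4 hq0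
  have hq20 : q ^ 2 ≠ 0 := pow_ne_zero 2 hq0
  have hS := (Equiv.ofBijective _ bijective_cosets).summable_iff.mpr
    (summable_theta_mul hq hq0 one_ne_zero one_ne_zero)
  have key : ∀ (a b : ℤ) (u v : ℤ),
      q * (((q ^ 5) ^ (u ^ 2) * (q ^ a) ^ u) * ((q ^ 5) ^ (v ^ 2) * (q ^ b) ^ v)) =
        q ^ (5 * u ^ 2 + a * u + 5 * v ^ 2 + b * v + 1) := by
    intro a b u v
    rw [show (q ^ 5 : ℂ) = q ^ (5 : ℤ) by norm_cast]
    simp only [← zpow_mul, ← zpow_add₀ hq0]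
    rw [mul_comm, ← zpow_add_one₀ hq0]
    congr 1
    ring
  have hcoset : ∀ (i : Fin 5) (a b : ℤ), (∀ u v : ℤ, (u - 2 * v + (cosetRep i).1) ^ 2 +
      (2 * u + v + (cosetRep i).2) ^ 2 = 5 * u ^ 2 + a * u + 5 * v ^ 2 + b * v + 1) →
      ∑' p : ℤ × ℤ, q ^ ((p.1 - 2 * p.2 + (cosetRep i).1) ^ 2 +
        (2 * p.1 + p.2 + (cosetRep i).2) ^ 2) =
      q * (thetaSeries (q ^ 5) (q ^ a) * thetaSeries (q ^ 5) (q ^ b)) := by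
    intro i a b h
    rw [thetaSeries_mul hq5 hq50 (zpow_ne_zero _ hq0) (zpow_ne_zero _ hq0), ← tsum_mul_left]
    refine tsum_congr fun p => ?_
    rw [h, key]
  have hcoset0 : ∑' p : ℤ × ℤ, q ^ ((p.1 - 2 * p.2 + (cosetRep 0).1) ^ 2 +
        (2 * p.1 + p.2 + (cosetRep 0).2) ^ 2) = thetaSeries (q ^ 5) 1 ^ 2 := by
    rw [sq, thetaSeries_mul hq5 hq50 one_ne_zero one_ne_zero]
    refine tsum_congr fun p => ?_
    have := key 0 0 p.1 p.2
    rw [zpow_add_one₀ hq0, mul_comm q] at this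
    simp only [zpow_zero] at this
    rw [mul_right_cancel₀ hq0 this]
    congr 1
    simp [cosetRep]
    ring
  have h1 := hcoset 1 2 (-4 : ℤ) (by intro u v; simp [cosetRep]; ring)
  have h2 := hcoset 2 (-2 : ℤ) 4 (by intro u v; simp [cosetRep]; ring)
  have h3 := hcoset 3 4 2 (by intro u v; simp [cosetRep]; ring)
  have h4 := hcoset 4 (-4 : ℤ) (-2 : ℤ) (by intro u v; simp [cosetRep]; ring)
  have c2 : q ^ (2 : ℤ) = q ^ 2 := by norm_cast
  have c4 : q ^ (4 : ℤ) = q ^ 4 := by norm_cast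
  simp only [zpow_neg, c2, c4, thetaSeries_inv] at h1 h2 h3 h4
  rw [sq, thetaSeries_mul hq hq0 one_ne_zero one_ne_zero,
    ← (Equiv.ofBijective _ bijective_cosets).tsum_eq]
  refine hS.tsum_prod.trans ?_
  rw [tsum_fintype]
  simp only [Function.comp_apply, Equiv.ofBijective_apply, one_zpow, mul_one, ← zpow_add₀ hq0]
  rw [Fin.sum_univ_five, hcoset0, h1, h2, h3, h4]
  ring

theorem qp_neg_self {q : ℂ} (hq : ‖q‖ < 1) :
    qp (-q) (q ^ 2) = E (q ^ 2) ^ 2 / (E q * E (q ^ 4)) := by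
  have hx : ‖q ^ 2‖ < 1 := norm_pow_lt_one hq two_ne_zero
  have h4 : ‖q ^ 4‖ < 1 := norm_pow_lt_one hq four_ne_zero
  have hsplit : ∀ {x : ℂ}, ‖x‖ < 1 → E x = qp x (x ^ 2) * E (x ^ 2) := by
    intro x hx
    rw [E_eq_qp, E_eq_qp, qp_dissection x hx two_ne_zero]
    simp [prod_range_succ, sq]
  have e1 := hsplit hq
  have e2 := hsplit hx
  have e3 := qp_mul_qp_neg q hx
  rw [← e3, ← pow_mul] at e2
  rw [eq_div_iff (mul_ne_zero (E_ne_zero hq) (E_ne_zero h4))]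
  linear_combination (E (q ^ 4) * qp (-q) (q ^ 2)) * e1 - E (q ^ 2) * e2

theorem thetaSeries_one {q : ℂ} (hq : ‖q‖ < 1) (hq0 : q ≠ 0) :
    thetaSeries q 1 = E (q ^ 2) ^ 5 / (E q ^ 2 * E (q ^ 4) ^ 2) := by
  rw [thetaSeries, jacobi_triple_product hq hq0 one_ne_zero, inv_one, one_mul, qp_neg_self hq]
  ring

theorem thetaSeries_mul_eq {q : ℂ} (hq : ‖q‖ < 1) (hq0 : q ≠ 0) :
    thetaSeries (q ^ 5) (q ^ 4) * thetaSeries (q ^ 5) (q ^ 2) =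
      E (q ^ 2) ^ 2 * E (q ^ 5) * E (q ^ 20) / (E q * E (q ^ 4)) := by
  have hpow : ∀ {n : ℕ}, n ≠ 0 → ‖q ^ n‖ < 1 := norm_pow_lt_one hq
  have hd := qp_dissection (-q) (hpow two_ne_zero) (m := 5) (by norm_num)
  have h5 := qp_neg_self (hpow (n := 5) (by norm_num))
  have hE5 := E_ne_zero (hpow (n := 5) (by norm_num))
  have hE10 := E_ne_zero (hpow (n := 10) (by norm_num))
  have hE20 := E_ne_zero (hpow (n := 20) (by norm_num))
  simp only [← pow_mul, Nat.reduceMul] at h5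
  rw [thetaSeries, thetaSeries, jacobi_triple_product (hpow (by norm_num)) (pow_ne_zero 5 hq0)
    (pow_ne_zero 4 hq0), jacobi_triple_product (hpow (by norm_num)) (pow_ne_zero 5 hq0)
    (pow_ne_zero 2 hq0)]
  have i4 : (q ^ 4)⁻¹ * q ^ 5 = q := by field_simp
  have i2 : (q ^ 2)⁻¹ * q ^ 5 = q ^ 3 := by field_simp
  rw [i4, i2]
  simp only [prod_range_succ, range_zero, prod_empty, one_mul, ← pow_mul, neg_mul, ← pow_succ',
    ← pow_add, Nat.reduceMul, Nat.reduceAdd, mul_zero, mul_one, h5, pow_one] at hd ⊢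
  rw [qp_neg_self hq] at hd
  have : E (q ^ 2) ^ 2 * E (q ^ 5) * E (q ^ 20) / (E q * E (q ^ 4)) =
    E (q ^ 2) ^ 2 / (E q * E (q ^ 4)) * (E (q ^ 5) * E (q ^ 20)) := by ring
  rw [this, hd]
  field_simp

theorem stmt_0 : ∀ q : ℂ, ‖q‖ < 1 →
    E (q ^ 2) ^ 10 / (E q ^ 4 * E (q ^ 4) ^ 4) - E (q ^ 10) ^ 10 / (E (q ^ 5) ^ 4 * E (q ^ 20) ^ 4)
      = 4 * q * E (q ^ 2) ^ 2 * E (q ^ 5) * E (q ^ 20) / (E q * E (q ^ 4)) := by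
  intro q hq
  rcases eq_or_ne q 0 with rfl | hq0
  · simp
  have hq5 : ‖q ^ 5‖ < 1 := norm_pow_lt_one hq (by norm_num)
  have h := thetaSeries_sq_eq hq hq0
  rw [thetaSeries_mul_eq hq hq0, thetaSeries_one hq hq0,
    thetaSeries_one hq5 (pow_ne_zero 5 hq0)] at h
  simp only [← pow_mul, Nat.reduceMul] at h
  linear_combination h
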